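/- Let F be a γ-pliable set family on a finite set V, let I be an inclusion-minimal cover of F such that every edge of I covers some F-core, let U be the union of all F-cores, let L be a laminar witness family for I augmented with V, let (S₀, S₁, …, S_ℓ) be a hollow chain in L, and for each i let a_i b_i be the unique edge of I covering S_i with a_i ∈ S_i. If a_i ∈ U for some 1 ≤ i ≤ ℓ, then ℓ = i. -/

import Mathlib

open scoped Classical

namespace SFEC

variable {V : Type*}

/-- An edge (an unordered pair of distinct elements) `e` covers a set `S`
if exactly one endpoint of `e` lies in `S`. -/
def Covers (e : Sym2 V) (S : Set V) : Prop :=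
  ∃ u v : V, e = s(u, v) ∧ u ∈ S ∧ v ∉ S

/-- `delta I S` is the set of edges of `I` with exactly one endpoint in `S`. -/
noncomputable def delta (I : Finset (Sym2 V)) (S : Set V) : Finset (Sym2 V) :=
  I.filter (fun e => Covers e S)

/-- `d I S = |delta I S|`. -/
noncomputable def d (I : Finset (Sym2 V)) (S : Set V) : ℕ := (delta I S).card

/-- A set family on `V`: a collection of subsets with `∅ ∉ F` and `V ∉ F`. -/
def IsSetFamily (F : Set (Set V)) : Prop := ∅ ∉ F ∧ Set.univ ∉ F

/-- `I` covers the family `F` if it covers every member of `F`. -/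
def CoversFam (I : Finset (Sym2 V)) (F : Set (Set V)) : Prop := ∀ S ∈ F, 1 ≤ d I S

/-- `I` is an inclusion-minimal cover of `F`. -/
def MinimalCover (I : Finset (Sym2 V)) (F : Set (Set V)) : Prop :=
  CoversFam I F ∧ ∀ J : Finset (Sym2 V), J ⊂ I → ¬ CoversFam J F

/-- At least two of the four statements hold. -/
def AtLeastTwo (p q r s : Prop) : Prop :=
  (p ∧ q) ∨ (p ∧ r) ∨ (p ∧ s) ∨ (q ∧ r) ∨ (q ∧ s) ∨ (r ∧ s)

/-- A family is pliable if for all `A, B ∈ F` at least two of the four sets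
`A ∩ B, A ∪ B, A \ B, B \ A` belong to `F`. -/
def Pliable (F : Set (Set V)) : Prop :=
  ∀ A ∈ F, ∀ B ∈ F, AtLeastTwo (A ∩ B ∈ F) (A ∪ B ∈ F) (A \ B ∈ F) (B \ A ∈ F)

/-- The residual family `F^I`: the members of `F` covered by no edge of `I`. -/
def Residual (F : Set (Set V)) (I : Finset (Sym2 V)) : Set (Set V) := {S ∈ F | d I S = 0}

/-- `A` and `B` cross if `A ∩ B`, `A \ B`, `B \ A` and `V \ (A ∪ B)` are all nonempty. -/
def Crosses (A B : Set V) : Prop :=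
  (A ∩ B).Nonempty ∧ (A \ B).Nonempty ∧ (B \ A).Nonempty ∧ ((A ∪ B)ᶜ : Set V).Nonempty

/-- An `F`-core: an inclusion-minimal member of `F`. -/
def Core (F : Set (Set V)) (C : Set V) : Prop := C ∈ F ∧ ∀ A ∈ F, A ⊆ C → A = C

/-- Property (γ). -/
def PropertyGamma (F : Set (Set V)) : Prop :=
  ∀ (J : Finset (Sym2 V)) (S₁ S₂ C : Set V),
    S₁ ∈ Residual F J → S₂ ∈ Residual F J → S₁ ⊂ S₂ →
    Core (Residual F J) C → Crosses C S₁ → Crosses C S₂ →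
    S₂ \ (S₁ ∪ C) = ∅ ∨ S₂ \ (S₁ ∪ C) ∈ Residual F J

/-- `F` is γ-pliable: pliable and satisfying Property (γ). -/
def GammaPliable (F : Set (Set V)) : Prop := Pliable F ∧ PropertyGamma F

/-- `S` is a witness set for the edge `e ∈ I` if `δ_I(S) = {e}`. -/
def WitnessSet (F : Set (Set V)) (I : Finset (Sym2 V)) (S : Set V) (e : Sym2 V) : Prop :=
  S ∈ F ∧ delta I S = {e}

/-- `L ⊆ F` is a witness family for `I`: `|L| = |I|` and each `e ∈ I` has a witness set in `L`. -/
def WitnessFamily (F : Set (Set V)) (I : Finset (Sym2 V)) (L : Finset (Set V)) : Prop :=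
  ↑L ⊆ F ∧ L.card = I.card ∧ ∀ e ∈ I, ∃ S ∈ L, WitnessSet F I S e

/-- A family is laminar if any two members are disjoint or one contains the other. -/
def Laminar (L : Finset (Set V)) : Prop :=
  ∀ A ∈ L, ∀ B ∈ L, A ⊆ B ∨ B ⊆ A ∨ Disjoint A B

/-- `S ∈ L` owns `C` if `S` is the inclusion-minimal member of `L` containing `C`. -/
def Owns (L : Finset (Set V)) (S C : Set V) : Prop :=
  S ∈ L ∧ C ⊆ S ∧ ∀ T ∈ L, C ⊆ T → S ⊆ T

/-- `S ∈ L` is hollow if it owns no `F`-core. -/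
def Hollow (F : Set (Set V)) (L : Finset (Set V)) (S : Set V) : Prop :=
  S ∈ L ∧ ∀ C : Set V, Core F C → ¬ Owns L S C

/-- `A` is the unique child of `S` in `L`: the unique maximal member of `L`
properly contained in `S`. -/
def UniqueChild (L : Finset (Set V)) (A S : Set V) : Prop :=
  A ∈ L ∧ A ⊂ S ∧ ∀ B ∈ L, B ⊂ S → B ⊆ A

/-- `(S 0, S 1, …, S ℓ)` is a hollow chain in `L`. -/
def HollowChain (F : Set (Set V)) (L : Finset (Set V)) (S : ℕ → Set V) (ℓ : ℕ) : Prop :=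
  (∀ i ≤ ℓ, S i ∈ L) ∧
  (∀ i, 1 ≤ i → i ≤ ℓ → Hollow F L (S i)) ∧
  S ℓ ≠ Set.univ ∧
  (∀ i, 1 ≤ i → i ≤ ℓ → UniqueChild L (S (i - 1)) (S i))

/-- `U`: the union of all `F`-cores. -/
def coreUnion (F : Set (Set V)) : Set V := ⋃₀ {C | Core F C}

/-- `F` is uncrossable. -/
def Uncrossable (F : Set (Set V)) : Prop :=
  ∀ A ∈ F, ∀ B ∈ F, (A ∩ B ∈ F ∧ A ∪ B ∈ F) ∨ (A \ B ∈ F ∧ B \ A ∈ F)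

/-- `F` is semi-uncrossable. -/
def SemiUncrossable (F : Set (Set V)) : Prop :=
  ∀ A ∈ F, ∀ B ∈ F,
    (A ∩ B ∈ F ∧ (A ∪ B ∈ F ∨ A \ B ∈ F ∨ B \ A ∈ F)) ∨ (A \ B ∈ F ∧ B \ A ∈ F)

end SFEC

open SFEC

namespace SFEC

variable {V : Type*}

lemma Core.nonempty {F : Set (Set V)} (hF : IsSetFamily F) {C : Set V} (hC : Core F C) :
    C.Nonempty :=
  Set.nonempty_iff_ne_empty.mpr fun h => hF.1 (h ▸ hC.1)

lemma exists_core_subset [Finite V] {F : Set (Set V)} {A : Set V} (hA : A ∈ F) :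
    ∃ C, Core F C ∧ C ⊆ A := by
  obtain ⟨C, hCA, hC⟩ := (Set.toFinite F).exists_le_minimal hA
  exact ⟨C, ⟨hC.prop, fun B hB hBC => hBC.antisymm (hC.le_of_le hB hBC)⟩, hCA⟩

/-- A core meeting a member of a pliable family that does not contain it crosses that member. -/
lemma Core.union_mem_and_sdiff_mem {F : Set (Set V)} (hp : Pliable F) {A C : Set V}
    (hC : Core F C) (hA : A ∈ F) (hAC : (A ∩ C).Nonempty) (hCA : ¬ C ⊆ A) :
    A ∪ C ∈ F ∧ A \ C ∈ F := by
  have hinter : A ∩ C ∉ F := fun h =>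
    hCA (Set.inter_eq_right.mp (hC.2 _ h Set.inter_subset_right))
  have hsdiff : C \ A ∉ F := fun h => by
    obtain ⟨x, hxA, hxC⟩ := hAC
    rw [← hC.2 _ h Set.sdiff_subset] at hxC
    exact hxC.2 hxA
  have := hp A hA C hC.1
  unfold AtLeastTwo at this
  tauto

lemma Core.crosses {F : Set (Set V)} (hF : IsSetFamily F) (hp : Pliable F) {A C : Set V}
    (hC : Core F C) (hA : A ∈ F) (hAC : (A ∩ C).Nonempty) (hCA : ¬ C ⊆ A) :
    Crosses C A := by
  obtain ⟨hunion, hsdiff⟩ := hC.union_mem_and_sdiff_mem hp hA hAC hCA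
  refine ⟨Set.inter_comm A C ▸ hAC, Set.sdiff_nonempty.mpr hCA,
    Set.nonempty_iff_ne_empty.mpr fun h => hF.1 (h ▸ hsdiff),
    Set.nonempty_compl.mpr fun h => hF.2 ?_⟩
  rwa [Set.union_comm, h] at hunion

lemma Core.eq_of_mem {F : Set (Set V)} (hp : Pliable F) {C D : Set V}
    (hC : Core F C) (hD : Core F D) {x : V} (hxC : x ∈ C) (hxD : x ∈ D) : C = D := by
  by_cases hDC : D ⊆ C
  · exact (hC.2 D hD.1 hDC).symm
  · obtain ⟨-, hsdiff⟩ := hD.union_mem_and_sdiff_mem hp hC.1 ⟨x, hxC, hxD⟩ hDC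
    rw [← hC.2 _ hsdiff Set.sdiff_subset] at hxC
    exact absurd hxD hxC.2

lemma residual_empty (F : Set (Set V)) : Residual F ∅ = F := by
  simp [Residual, d, delta]

lemma covers_mk {u v : V} {A : Set V} :
    Covers s(u, v) A ↔ (u ∈ A ∧ v ∉ A) ∨ (v ∈ A ∧ u ∉ A) := by
  constructor
  · rintro ⟨x, y, h, hx, hy⟩
    rcases Sym2.eq_iff.mp h with ⟨rfl, rfl⟩ | ⟨rfl, rfl⟩
    · exact Or.inl ⟨hx, hy⟩
    · exact Or.inr ⟨hx, hy⟩
  · rintro (⟨hu, hv⟩ | ⟨hv, hu⟩)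
    · exact ⟨u, v, rfl, hu, hv⟩
    · exact ⟨v, u, Sym2.eq_swap, hv, hu⟩

lemma WitnessFamily.delta_injOn {F : Set (Set V)} {I : Finset (Sym2 V)} {L : Finset (Set V)}
    (h : WitnessFamily F I L) : Set.InjOn (delta I) (L : Set (Set V)) := by
  obtain ⟨-, hcard, hw⟩ := h
  choose! f hfL hf using hw
  have hinj : Set.InjOn f (I : Set (Sym2 V)) := fun e he e' he' hee => by
    have := (hf e he).2
    rw [hee, (hf e' he').2] at this
    exact (Finset.singleton_injective this).symm
  have himage : I.image f = L := Finset.eq_of_subset_of_card_le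
    (Finset.image_subset_iff.mpr hfL) (by rw [Finset.card_image_of_injOn hinj, hcard])
  intro A hA B hB hAB
  rw [← himage, Finset.mem_coe, Finset.mem_image] at hA hB
  obtain ⟨e, he, rfl⟩ := hA
  obtain ⟨e', he', rfl⟩ := hB
  rw [(hf e he).2, (hf e' he').2] at hAB
  rw [Finset.singleton_injective hAB]

/-- A core contained in a hollow set is contained in the unique child of that set. -/
lemma Hollow.core_subset_child {F : Set (Set V)} (hF : IsSetFamily F) {L : Finset (Set V)}
    (hlam : Laminar L) {A S C : Set V} (hS : Hollow F (insert Set.univ L) S)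
    (hne : S ≠ Set.univ) (hA : UniqueChild (insert Set.univ L) A S) (hC : Core F C)
    (hCS : C ⊆ S) : C ⊆ A := by
  have hown := hS.2 C hC
  simp only [Owns, not_and, not_forall] at hown
  obtain ⟨T, hT, hCT, hST⟩ := hown hS.1 hCS
  have hTne : T ≠ Set.univ := by
    rintro rfl
    exact hST (Set.subset_univ S)
  have hTS : T ⊆ S := by
    rcases hlam T ((Finset.mem_insert.mp hT).resolve_left hTne) S
      ((Finset.mem_insert.mp hS.1).resolve_left hne) with h | h | h
    · exact h
    · exact absurd h hST
    · obtain ⟨x, hx⟩ := hC.nonempty hF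
      exact absurd (hCS hx) (Set.disjoint_left.mp h (hCT hx))
  exact hCT.trans (hA.2.2 T hT ⟨hTS, hST⟩)

end SFEC

theorem stmt_10
    {V : Type*} [Fintype V]
    (F : Set (Set V)) (hF : IsSetFamily F) (hgp : GammaPliable F)
    (I : Finset (Sym2 V)) (hIe : ∀ e ∈ I, ¬ e.IsDiag)
    (hmin : MinimalCover I F)
    (hcov : ∀ e ∈ I, ∃ C : Set V, Core F C ∧ Covers e C)
    (L : Finset (Set V)) (hWF : WitnessFamily F I L) (hlam : Laminar L)
    (S : ℕ → Set V) (ℓ : ℕ)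
    (hchain : HollowChain F (insert Set.univ L) S ℓ)
    (a b : ℕ → V)
    (hedge : ∀ i ≤ ℓ, s(a i, b i) ∈ I ∧ a i ∈ S i ∧ b i ∉ S i ∧
      delta I (S i) = {s(a i, b i)})
    (i : ℕ) (hi1 : 1 ≤ i) (hiℓ : i ≤ ℓ)
    (haU : a i ∈ coreUnion F) :
    ℓ = i := by
  by_contra hne
  have hlt : i + 1 ≤ ℓ := by omega
  obtain ⟨hSL, hhollow, -, hchild⟩ := hchain
  have hp := hgp.1
  have hSne : ∀ j ≤ ℓ, S j ≠ Set.univ := fun j hj h =>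
    (hedge j hj).2.2.1 (h ▸ Set.mem_univ _)
  have hSL' : ∀ j ≤ ℓ, S j ∈ L := fun j hj =>
    (Finset.mem_insert.mp (hSL j hj)).resolve_left (hSne j hj)
  have hSF : ∀ j ≤ ℓ, S j ∈ F := fun j hj => hWF.1 (hSL' j hj)
  have hstep : ∀ j, 1 ≤ j → j ≤ ℓ → ∀ D, Core F D → D ⊆ S j → D ⊆ S (j - 1) :=
    fun j hj hjℓ D hD hDS => (hhollow j hj hjℓ).core_subset_child hF hlam (hSne j hjℓ)
      (hchild j hj hjℓ) hD hDS
  have hnot_covers : ∀ j k, j ≤ ℓ → k ≤ ℓ → S j ≠ S k → ¬ Covers s(a j, b j) (S k) := by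
    intro j k hj hk hjk hcovers
    have hmem : s(a j, b j) ∈ delta I (S k) :=
      Finset.mem_filter.mpr ⟨(hedge j hj).1, hcovers⟩
    rw [(hedge k hk).2.2.2, Finset.mem_singleton] at hmem
    refine hjk (hWF.delta_injOn (hSL' j hj) (hSL' k hk) ?_)
    rw [(hedge j hj).2.2.2, (hedge k hk).2.2.2, hmem]
  obtain ⟨he, haS, hbS, -⟩ := hedge i hiℓ
  have hprev : S (i - 1) ⊂ S i := (hchild i hi1 hiℓ).2.1
  have hnext : S i ⊂ S (i + 1) := (hchild (i + 1) (by omega) hlt).2.1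
  have ha : a i ∉ S (i - 1) := fun h => hnot_covers i (i - 1) hiℓ (by omega) hprev.ne'
    (covers_mk.mpr (Or.inl ⟨h, fun hb => hbS (hprev.subset hb)⟩))
  have hb : b i ∈ S (i + 1) := by
    by_contra h
    exact hnot_covers i (i + 1) hiℓ hlt hnext.ne
      (covers_mk.mpr (Or.inl ⟨hnext.subset haS, h⟩))
  obtain ⟨C, hC : Core F C, haC⟩ := haU
  have hCi : ¬ C ⊆ S i := fun h => ha (hstep i hi1 hiℓ C hC h haC)
  have hCi' : ¬ C ⊆ S (i + 1) := fun h => hCi (hstep (i + 1) (by omega) hlt C hC h)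
  have hγ := hgp.2 ∅ (S i) (S (i + 1)) C
  rw [residual_empty] at hγ
  have hbC : b i ∈ C := by
    rcases hγ (hSF i hiℓ) (hSF _ hlt) hnext hC
      (hC.crosses hF hp (hSF i hiℓ) ⟨a i, haS, haC⟩ hCi)
      (hC.crosses hF hp (hSF _ hlt) ⟨a i, hnext.subset haS, haC⟩ hCi') with h | h
    · exact (Set.sdiff_eq_empty.mp h hb).resolve_left hbS
    · obtain ⟨D, hD, hDsub⟩ := exists_core_subset h
      obtain ⟨x, hx⟩ := hD.nonempty hF
      exact absurd (Or.inl (hstep (i + 1) (by omega) hlt D hD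
        (hDsub.trans Set.sdiff_subset) hx)) (hDsub hx).2
  obtain ⟨D, hD, hcovers⟩ := hcov _ he
  rcases covers_mk.mp hcovers with ⟨haD, hbD⟩ | ⟨hbD, haD⟩
  · exact hbD (hC.eq_of_mem hp hD haC haD ▸ hbC)
  · exact haD (hC.eq_of_mem hp hD hbC hbD ▸ haC)
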